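/- Let A be a unital C*-algebra whose primitive spectrum is Hausdorff, with center Z. For states ω and ρ on A, ρ lies in the weak* closure of ω∘E(A) if and only if ρ|Z = ω|Z. -/

import Mathlib

universe u

open scoped ComplexConjugate ComplexOrder

noncomputable section

variable {A : Type u} [NormedRing A] [StarRing A] [CStarRing A]
  [NormedAlgebra ℂ A] [StarModule ℂ A] [CompleteSpace A]

/-- A linear functional on a C*-algebra is positive if it is nonnegative
on all elements of the form `a* a`. -/
def IsPositiveFunctional (ω : A →L[ℂ] ℂ) : Prop :=
  ∀ a : A, 0 ≤ ω (star a * a)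

/-- A state is a positive unital linear functional. -/
def IsState (ω : A →L[ℂ] ℂ) : Prop :=
  IsPositiveFunctional ω ∧ ω 1 = 1

/-- A hermitian (self-adjoint) linear functional. -/
def IsHermitianFunctional (ω : A →L[ℂ] ℂ) : Prop :=
  ∀ a : A, ω (star a) = conj (ω a)

/-- `ωp`, `ωm` form the Jordan decomposition of the hermitian functional `ω`. -/
def IsJordanDecomposition (ω ωp ωm : A →L[ℂ] ℂ) : Prop :=
  IsPositiveFunctional ωp ∧ IsPositiveFunctional ωm ∧ ω = ωp - ωm ∧ ‖ω‖ = ‖ωp‖ + ‖ωm‖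

/-- An element of a C*-algebra is positive iff it is of the form `b* b`. -/
def IsPositiveElem (c : A) : Prop :=
  ∃ b : A, c = star b * b

/-- `E(A)`: the unital completely positive elementary maps
`x ↦ ∑ i, (a i)* x (a i)` with `∑ i, (a i)* (a i) = 1`. -/
def IsElementaryUCP (φ : A →L[ℂ] A) : Prop :=
  ∃ (n : ℕ) (a : Fin n → A), (∑ i, star (a i) * a i) = 1 ∧
    ∀ x : A, φ x = ∑ i, star (a i) * x * a i

/-- The set `ω ∘ E(A) = {ω ∘ φ : φ ∈ E(A)}`. -/
def mixSet (ω : A →L[ℂ] ℂ) : Set (A →L[ℂ] ℂ) :=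
  {ρ | ∃ φ : A →L[ℂ] A, IsElementaryUCP φ ∧ ρ = ω.comp φ}

/-- Membership in the weak* closure of a set of functionals: every basic weak*
neighbourhood of `ρ` (given by finitely many points and `ε > 0`) meets `S`. -/
def InWeakStarClosure (S : Set (A →L[ℂ] ℂ)) (ρ : A →L[ℂ] ℂ) : Prop :=
  ∀ ε : ℝ, 0 < ε → ∀ (n : ℕ) (x : Fin n → A), ∃ σ ∈ S, ∀ i, ‖ρ (x i) - σ (x i)‖ < ε

/-- Norm-closed two-sided ideals (which in a C*-algebra are automatically
`*`-closed `ℂ`-submodules). -/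
def IsClosedIdeal (J : Set A) : Prop :=
  IsClosed J ∧ (0 : A) ∈ J ∧ (∀ x ∈ J, ∀ y ∈ J, x + y ∈ J) ∧
    (∀ (c : ℂ), ∀ x ∈ J, c • x ∈ J) ∧ (∀ (a : A), ∀ x ∈ J, a * x ∈ J ∧ x * a ∈ J)

/-- The norm `‖ω|J‖` of the restriction of a functional `ω` to a subset `J`. -/
def normRestrict (ω : A →L[ℂ] ℂ) (J : Set A) : ℝ :=
  sSup {r : ℝ | ∃ x ∈ J, ‖x‖ ≤ 1 ∧ r = ‖ω x‖}

/-- The norm `‖cω‖` of the functional `x ↦ ω (c * x)`. -/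
def mulNorm (ω : A →L[ℂ] ℂ) (c : A) : ℝ :=
  sSup {r : ℝ | ∃ x : A, ‖x‖ ≤ 1 ∧ r = ‖ω (c * x)‖}

/-- A state `ω` is maximally mixed if every state `ρ` that is more mixed than `ω`
(i.e. `ρ` lies in the weak* closure of `ω ∘ E(A)`) satisfies in turn that `ω` is
more mixed than `ρ`. -/
def IsMaximallyMixed (ω : A →L[ℂ] ℂ) : Prop :=
  IsState ω ∧ ∀ ρ : A →L[ℂ] ℂ, IsState ρ →
    InWeakStarClosure (mixSet ω) ρ → InWeakStarClosure (mixSet ρ) ω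

/-- Maximal (norm-closed two-sided) ideals. -/
def IsMaximalIdeal (N : Set A) : Prop :=
  IsClosedIdeal N ∧ N ≠ Set.univ ∧
    ∀ N' : Set A, IsClosedIdeal N' → N' ≠ Set.univ → N ⊆ N' → N' = N

/-- The strong radical: the intersection of all maximal ideals. -/
def strongRadical (A : Type u) [NormedRing A] [StarRing A] [CStarRing A]
    [NormedAlgebra ℂ A] [StarModule ℂ A] [CompleteSpace A] : Set A :=
  ⋂₀ {N : Set A | IsMaximalIdeal N}

/-- A witness that `P` is the kernel of an irreducible representation of `A`
on some Hilbert space. -/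
structure IrreducibleRepWitness (A : Type u) [NormedRing A] [StarRing A] [CStarRing A]
    [NormedAlgebra ℂ A] [StarModule ℂ A] [CompleteSpace A] (P : Set A) :
    Type (u + 1) where
  /-- the Hilbert space of the representation -/
  space : Type u
  [nacg : NormedAddCommGroup space]
  [ips : InnerProductSpace ℂ space]
  [cplt : CompleteSpace space]
  [nontriv : Nontrivial space]
  /-- the representation -/
  π : A →L[ℂ] (space →L[ℂ] space)
  map_mul' : ∀ x y : A, π (x * y) = π x * π y
  map_star' : ∀ x : A, π (star x) = star (π x)
  map_one' : π 1 = 1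
  /-- topological irreducibility: every nonzero vector is cyclic -/
  irreducible' : ∀ ξ : space, ξ ≠ 0 → Dense {η : space | ∃ a : A, η = π a ξ}
  ker_eq' : P = {a : A | π a = 0}

/-- `P` is a primitive ideal: the kernel of some irreducible representation. -/
def IsPrimitiveIdeal (P : Set A) : Prop :=
  Nonempty (IrreducibleRepWitness A P)

/-- The primitive spectrum of `A` is Hausdorff: any two distinct points of the
primitive spectrum can be separated by disjoint basic open sets of the
hull-kernel topology. -/
def HasHausdorffPrimitiveSpectrum
    (A : Type u) [NormedRing A] [StarRing A] [CStarRing A]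
    [NormedAlgebra ℂ A] [StarModule ℂ A] [CompleteSpace A] : Prop :=
  ∀ P Q : Set A, IsPrimitiveIdeal P → IsPrimitiveIdeal Q → P ≠ Q →
    ∃ I J : Set A, IsClosedIdeal I ∧ IsClosedIdeal J ∧ ¬I ⊆ P ∧ ¬J ⊆ Q ∧
      ∀ S : Set A, IsPrimitiveIdeal S → I ⊆ S ∨ J ⊆ S


section Helpers

open scoped InnerProductSpace

theorem aux_im_zero {B : Type u} [CStarAlgebra B] (f : B →L[ℂ] ℂ) (hf : ‖f‖ ≤ 1) (h1 : f 1 = 1)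
    (a : B) (ha : IsSelfAdjoint a) : (f a).im = 0 := by
  have key : ∀ s : ℝ, (f a).im ^ 2 + 2 * (f a).im * s ≤ ‖a‖ ^ 2 := by
    intro s
    set b : B := a + (Complex.I * s) • (1 : B) with hb
    have hfb : f b = f a + Complex.I * s := by simp [hb, h1]
    have hle : ‖f b‖ ≤ ‖b‖ := by
      simpa using (f.le_opNorm b).trans (mul_le_mul_of_nonneg_right hf (norm_nonneg b))
    have hbb : star b * b = a * a + ((s ^ 2 : ℝ) : ℂ) • (1 : B) := by
      simp only [hb, star_add, star_smul, ha.star_eq, star_one, add_mul, mul_add, smul_mul_assoc,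
        mul_smul_comm, one_mul, mul_one]
      have : star (Complex.I * (s : ℂ)) = - (Complex.I * s) := by simp
      rw [this]
      have h2 : -(Complex.I * (s:ℂ)) * (Complex.I * s) = ((s ^ 2 : ℝ) : ℂ) := by
        push_cast
        linear_combination (-(s:ℂ)^2) * Complex.I_mul_I
      rw [← h2]
      module
    have hn : ‖b‖ ^ 2 ≤ ‖a‖ ^ 2 + s ^ 2 := by
      have h3 : ‖b‖ ^ 2 = ‖star b * b‖ := by rw [CStarRing.norm_star_mul_self, sq]
      rw [h3, hbb]
      refine (norm_add_le _ _).trans ?_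
      gcongr
      · rw [sq]; exact norm_mul_le _ _
      · rw [norm_smul]
        have : ‖(1 : B)‖ ≤ 1 := by
          rcases subsingleton_or_nontrivial B with h | h
          · simp [Subsingleton.elim (1 : B) 0]
          · simp
        calc ‖((s ^ 2 : ℝ) : ℂ)‖ * ‖(1 : B)‖ ≤ ‖((s ^ 2 : ℝ) : ℂ)‖ * 1 := by gcongr
          _ = s ^ 2 := by simp
    have hsq : ‖f b‖ ^ 2 = (f a).re ^ 2 + ((f a).im + s) ^ 2 := by
      rw [hfb, Complex.sq_norm, Complex.normSq_apply]
      simp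
      ring
    have : ‖f b‖ ^ 2 ≤ ‖b‖ ^ 2 := by gcongr
    nlinarith [sq_nonneg (f a).re]
  by_contra h
  have := key ((‖a‖ ^ 2 + 1) / (2 * (f a).im))
  have h2 : 2 * (f a).im * ((‖a‖ ^ 2 + 1) / (2 * (f a).im)) = ‖a‖ ^ 2 + 1 := by
    field_simp
  nlinarith [sq_nonneg (f a).im]

theorem aux_pos {B : Type u} [CStarAlgebra B] [PartialOrder B] [StarOrderedRing B]
    (f : B →L[ℂ] ℂ) (hf : ‖f‖ ≤ 1) (h1 : f 1 = 1)
    (a : B) (ha : 0 ≤ a) : 0 ≤ f a := by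
  have him := aux_im_zero f hf h1 a ha.isSelfAdjoint
  rw [Complex.nonneg_iff]
  refine ⟨?_, him.symm⟩
  -- b = ‖a‖ - a has norm at most ‖a‖
  have hb : ‖algebraMap ℝ B ‖a‖ - a‖ ≤ ‖a‖ := by
    have h0 : 0 ≤ algebraMap ℝ B ‖a‖ - a :=
      sub_nonneg.mpr (IsSelfAdjoint.le_algebraMap_norm_self ha.isSelfAdjoint)
    rw [CStarAlgebra.norm_le_iff_le_algebraMap _ (norm_nonneg a) h0]
    simpa using ha
  have hle : ‖f (algebraMap ℝ B ‖a‖ - a)‖ ≤ ‖a‖ := by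
    have := (f.le_opNorm _).trans (mul_le_mul hf hb (norm_nonneg _) zero_le_one)
    simpa using this
  have hfa : f (algebraMap ℝ B ‖a‖) = (‖a‖ : ℂ) := by
    rw [Algebra.algebraMap_eq_smul_one, ← Complex.coe_smul]
    simp [h1]
  rw [map_sub, hfa] at hle
  have := (Complex.abs_re_le_norm _).trans hle
  simp at this
  have := (abs_le.mp this).2
  linarith

theorem aux_exists_functional {B : Type u} [CStarAlgebra B] (L : Ideal B) (hL : (1 : B) ∉ L) :
    ∃ f : B →L[ℂ] ℂ, ‖f‖ ≤ 1 ∧ f 1 = 1 ∧ ∀ x ∈ L, f x = 0 := by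
  set M : Submodule ℂ B := L.restrictScalars ℂ with hM
  have hnt : Nontrivial B := ⟨1, 0, fun h => hL (h ▸ L.zero_mem)⟩
  have hq : ‖(M.mkQ 1 : B ⧸ M)‖ = 1 := by
    apply le_antisymm
    · have := Submodule.Quotient.norm_mk_le M (1 : B)
      simpa using this
    · by_contra hlt
      push Not at hlt
      obtain ⟨m, hm, hmn⟩ := Submodule.Quotient.norm_mk_lt (M.mkQ 1 : B ⧸ M)
        (sub_pos.mpr hlt)
      have hm1 : ‖m‖ < 1 := by linarith
      have hmem : 1 - m ∈ L := by
        have : (Submodule.Quotient.mk (1 : B) : B ⧸ M) = Submodule.Quotient.mk m := hm.symm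
        rw [Submodule.Quotient.eq] at this
        exact this
      have hu : IsUnit (1 - m) := isUnit_one_sub_of_norm_lt_one hm1
      exact hL ((Ideal.eq_top_of_isUnit_mem L hmem hu) ▸ Submodule.mem_top)
  obtain ⟨g, hg, hg1⟩ := exists_dual_vector'' ℂ (M.mkQ 1 : B ⧸ M)
  refine ⟨LinearMap.mkContinuous ((g : (B ⧸ M) →ₗ[ℂ] ℂ) ∘ₗ M.mkQ) 1 ?_, ?_, ?_, ?_⟩
  · intro x
    calc ‖g (M.mkQ x)‖ ≤ ‖g‖ * ‖M.mkQ x‖ := g.le_opNorm _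
      _ ≤ 1 * ‖x‖ := by
        gcongr
        exact Submodule.Quotient.norm_mk_le M x
  · exact LinearMap.mkContinuous_norm_le _ zero_le_one _
  · rw [hq] at hg1
    simpa using hg1
  · intro x hx
    have : M.mkQ x = 0 := (Submodule.Quotient.mk_eq_zero M).mpr hx
    show g (M.mkQ x) = 0
    rw [this, map_zero]

end Helpers

section Helpers2

open scoped InnerProductSpace

theorem aux_locallyConvex (B : Type u) [CStarAlgebra B] :
    LocallyConvexSpace ℝ (WeakDual ℂ B) := by
  have : LocallyConvexSpace ℝ (WeakBilin (topDualPairing ℂ B)) :=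
    WeakBilin.locallyConvexSpace
  exact this

/-- Irreducible representations of `B`. -/
structure IrrRep (B : Type u) [CStarAlgebra B] : Type (u + 1) where
  H : Type u
  [nacg : NormedAddCommGroup H]
  [ips : InnerProductSpace ℂ H]
  [cplt : CompleteSpace H]
  [nontriv : Nontrivial H]
  π : B →⋆ₐ[ℂ] (H →L[ℂ] H)
  irr : ∀ ξ : H, ξ ≠ 0 → Dense {η : H | ∃ a : B, η = π a ξ}

attribute [instance] IrrRep.nacg IrrRep.ips IrrRep.cplt IrrRep.nontriv

/-- The set of norm-one unital functionals vanishing on `L`. -/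
def auxStates {B : Type u} [CStarAlgebra B] (L : Ideal B) : Set (B →L[ℂ] ℂ) :=
  {f | ‖f‖ ≤ 1 ∧ f 1 = 1 ∧ ∀ x ∈ L, f x = 0}

theorem aux_extreme {B : Type u} [CStarAlgebra B] (L : Ideal B) (hL : (1 : B) ∉ L) :
    ∃ f ∈ auxStates L, ∀ f₁ ∈ auxStates L, ∀ f₂ ∈ auxStates L, ∀ t : ℝ, 0 < t → t < 1 →
      f = (t : ℂ) • f₁ + ((1 - t : ℝ) : ℂ) • f₂ → f₁ = f := by
  have := aux_locallyConvex B
  let S : Set (WeakDual ℂ B) := WeakDual.toStrongDual ⁻¹' (auxStates L)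
  have hS : S = (WeakDual.toStrongDual ⁻¹' Metric.closedBall (0 : StrongDual ℂ B) 1) ∩
      ({f : WeakDual ℂ B | f 1 = 1} ∩ ⋂ x ∈ L, {f : WeakDual ℂ B | f x = 0}) := by
    ext f
    simp [S, auxStates]
  have hcl : IsClosed ({f : WeakDual ℂ B | f 1 = 1} ∩ ⋂ x ∈ L, {f : WeakDual ℂ B | f x = 0}) := by
    refine IsClosed.inter (isClosed_eq (WeakDual.eval_continuous 1) continuous_const) ?_
    exact isClosed_biInter fun x _ => isClosed_eq (WeakDual.eval_continuous x) continuous_const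
  have hc : IsCompact S := by
    rw [hS]
    exact (WeakDual.isCompact_closedBall (0 : StrongDual ℂ B) 1).inter_right hcl
  have hne : S.Nonempty := by
    obtain ⟨f, hf⟩ := aux_exists_functional L hL
    exact ⟨StrongDual.toWeakDual f, hf⟩
  obtain ⟨f, hf⟩ := hc.extremePoints_nonempty hne
  rw [mem_extremePoints] at hf
  refine ⟨WeakDual.toStrongDual f, hf.1, ?_⟩
  intro f₁ h₁ f₂ h₂ t ht0 ht1 heq
  have := hf.2 (StrongDual.toWeakDual f₁) h₁ (StrongDual.toWeakDual f₂) h₂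
    ⟨t, 1 - t, ht0, by linarith, by ring, by
      refine DFunLike.ext _ _ fun x => ?_
      have := congrArg (fun g : B →L[ℂ] ℂ => g x) heq
      simp at this
      show t • f₁ x + (1 - t) • f₂ x = f x
      rw [Complex.real_smul, Complex.real_smul]
      push_cast
      exact this.symm⟩
  exact this.1

theorem aux_gns {B : Type u} [CStarAlgebra B] [PartialOrder B] [StarOrderedRing B]
    (f : B →L[ℂ] ℂ) (hf : ‖f‖ ≤ 1) (h1 : f 1 = 1) :
    ∃ (H : Type u) (_ : NormedAddCommGroup H) (_ : InnerProductSpace ℂ H) (_ : CompleteSpace H)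
      (π : B →⋆ₐ[ℂ] (H →L[ℂ] H)) (Ω : H), (∀ a, f a = ⟪Ω, π a Ω⟫_ℂ) ∧
        Dense {η : H | ∃ a : B, η = π a Ω} := by
  let F : B →ₚ[ℂ] ℂ := PositiveLinearMap.mk₀ (f : B →ₗ[ℂ] ℂ) (fun x hx => aux_pos f hf h1 x hx)
  have hF : ∀ x, F x = f x := fun x => rfl
  have hact : ∀ a : B, F.gnsStarAlgHom a ((F.toPreGNS 1 : F.PreGNS) : F.GNS) =
      ((F.toPreGNS a : F.PreGNS) : F.GNS) := by
    intro a
    show F.gnsNonUnitalStarAlgHom a _ = _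
    rw [PositiveLinearMap.gnsNonUnitalStarAlgHom_apply_coe]
    simp
  refine ⟨F.GNS, inferInstance, inferInstance, inferInstance, F.gnsStarAlgHom,
    ((F.toPreGNS 1 : F.PreGNS) : F.GNS), ?_, ?_⟩
  · intro a
    rw [hact, UniformSpace.Completion.inner_coe, PositiveLinearMap.preGNS_inner_def]
    simp [hF]
  · have hd : DenseRange (fun x : F.PreGNS => (x : F.GNS)) :=
      UniformSpace.Completion.denseRange_coe
    refine Dense.mono ?_ hd
    rintro _ ⟨x, rfl⟩
    exact ⟨F.ofPreGNS x, by rw [hact]; simp⟩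

/-- vector functional -/
theorem aux_vecFunctional {B : Type u} [CStarAlgebra B] {H : Type u} [NormedAddCommGroup H]
    [InnerProductSpace ℂ H] [CompleteSpace H] (π : B →⋆ₐ[ℂ] (H →L[ℂ] H)) (v : H) :
    ∃ g : B →L[ℂ] ℂ, ‖g‖ ≤ ‖v‖ ^ 2 ∧ ∀ a, g a = ⟪v, π a v⟫_ℂ := by
  let g0 : B →ₗ[ℂ] ℂ :=
    { toFun := fun a => ⟪v, π a v⟫_ℂ
      map_add' := fun a b => by simp
      map_smul' := fun c a => by simp }
  have hb : ∀ a, ‖g0 a‖ ≤ ‖v‖ ^ 2 * ‖a‖ := by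
    intro a
    calc ‖⟪v, π a v⟫_ℂ‖ ≤ ‖v‖ * ‖π a v‖ := norm_inner_le_norm _ _
      _ ≤ ‖v‖ * (‖a‖ * ‖v‖) := by
        gcongr
        exact ((π a).le_opNorm v).trans
          (mul_le_mul_of_nonneg_right (NonUnitalStarAlgHom.norm_apply_le π a) (norm_nonneg v))
      _ = ‖v‖ ^ 2 * ‖a‖ := by ring
  exact ⟨g0.mkContinuous _ hb, LinearMap.mkContinuous_norm_le _ (by positivity) _, fun a => rfl⟩

theorem aux_irr {B : Type u} [CStarAlgebra B] [PartialOrder B] [StarOrderedRing B]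
    (L : Ideal B) (hL : (1 : B) ∉ L) :
    ∃ (R : IrrRep B) (ξ : R.H), ξ ≠ 0 ∧ ∀ x ∈ L, R.π x ξ = 0 := by
  obtain ⟨f, hf, hext⟩ := aux_extreme L hL
  obtain ⟨H, _, _, _, π, Ω, hfΩ, hdense⟩ := aux_gns f hf.1 hf.2.1
  have hΩ : ⟪Ω, Ω⟫_ℂ = 1 := by
    have := hfΩ 1
    rw [hf.2.1] at this
    simpa using this.symm
  have hΩn : ‖Ω‖ = 1 := by
    have : ‖Ω‖ ^ 2 = 1 := by rw [← inner_self_eq_norm_sq (𝕜 := ℂ), hΩ]; simp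
    nlinarith [norm_nonneg Ω]
  have hΩ0 : Ω ≠ 0 := by
    intro h; simp [h] at hΩn
  have hadj : ∀ (a : B) (x y : H), ⟪π a x, y⟫_ℂ = ⟪x, π (star a) y⟫_ℂ := by
    intro a x y
    rw [map_star, ContinuousLinearMap.star_eq_adjoint, ContinuousLinearMap.adjoint_inner_right]
  have hkill : ∀ x ∈ L, π x Ω = 0 := by
    intro x hx
    have h := hf.2.2 _ (L.mul_mem_left (star x) hx)
    rw [hfΩ, map_mul, mul_apply_eq_comp, ← hadj] at h
    exact inner_self_eq_zero.mp h
  have : Nontrivial H := ⟨Ω, 0, hΩ0⟩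
  refine ⟨⟨H, π, ?_⟩, Ω, hΩ0, hkill⟩
  intro ξ hξ
  let ev : B →ₗ[ℂ] H :=
    { toFun := fun a => π a ξ
      map_add' := fun a b => by simp
      map_smul' := fun c a => by simp }
  let M : Submodule ℂ H := (LinearMap.range ev).topologicalClosure
  have hMc : IsClosed (M : Set H) := Submodule.isClosed_topologicalClosure _
  have : CompleteSpace M := hMc.completeSpace_coe
  have hinv : ∀ a : B, ∀ v ∈ M, π a v ∈ M := by
    intro a v hv
    refine map_mem_closure (π a).continuous hv ?_
    rintro _ ⟨b, rfl⟩
    exact ⟨a * b, by simp [ev]⟩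
  have hinv' : ∀ a : B, ∀ v ∈ Mᗮ, π a v ∈ Mᗮ := by
    intro a v hv
    rw [Submodule.mem_orthogonal] at hv ⊢
    intro u hu
    have := hv _ (hinv (star a) u hu)
    rwa [hadj, star_star] at this
  let p : H →L[ℂ] H := M.starProjection
  have hcomm : ∀ (a : B) (v : H), p (π a v) = π a (p v) := by
    intro a v
    refine Submodule.eq_starProjection_of_mem_orthogonal
      (hinv a _ (Submodule.starProjection_apply_mem M v)) ?_
    rw [← map_sub]
    exact hinv' a _ (Submodule.sub_starProjection_mem_orthogonal v)
  have hpsa : ∀ x y : H, ⟪p x, y⟫_ℂ = ⟪x, p y⟫_ℂ := fun x y =>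
    Submodule.inner_starProjection_left_eq_right M x y
  have hpp : ∀ x : H, p (p x) = p x := fun x =>
    Submodule.starProjection_eq_self_iff.mpr (Submodule.starProjection_apply_mem M x)
  have hξM : ξ ∈ M := Submodule.le_topologicalClosure _ ⟨1, by simp [ev]⟩
  have hpξ : p ξ = ξ := Submodule.starProjection_eq_self_iff.mpr hξM
  -- an operator identity from its value at Ω
  have hscal : ∀ c : ℂ, p Ω = c • Ω → ∀ v, p v = c • v := by
    intro c hc v
    have hcl : IsClosed {v : H | p v = c • v} := isClosed_eq p.continuous (by fun_prop)
    have hsub : {η : H | ∃ a : B, η = π a Ω} ⊆ {v : H | p v = c • v} := by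
      rintro _ ⟨a, rfl⟩
      simp [hcomm, hc]
    have := hcl.closure_subset_iff.mpr hsub
    rw [hdense.closure_eq] at this
    exact this (Set.mem_univ v)
  have htop : p Ω = Ω → Dense {η : H | ∃ a : B, η = π a ξ} := by
    intro h v
    have h1 : p v = v := by simpa using hscal 1 (by simpa using h) v
    have h2 : v ∈ M := Submodule.starProjection_eq_self_iff.mp h1
    have h3 : v ∈ closure (Set.range ev) := h2
    refine closure_mono ?_ h3
    rintro _ ⟨b, rfl⟩
    exact ⟨b, rfl⟩
  have hzero : p Ω ≠ 0 := by
    intro h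
    have := hscal 0 (by simpa using h) ξ
    rw [hpξ, zero_smul] at this
    exact hξ this
  by_cases hone : p Ω = Ω
  · exact htop hone
  exfalso
  have hort : ⟪p Ω, Ω - p Ω⟫_ℂ = 0 := by
    rw [hpsa, map_sub, hpp, sub_self, inner_zero_right]
  have hsum : ‖p Ω‖ ^ 2 + ‖Ω - p Ω‖ ^ 2 = 1 := by
    have := norm_add_sq_eq_norm_sq_add_norm_sq_of_inner_eq_zero (p Ω) (Ω - p Ω) hort
    rw [add_sub_cancel, hΩn] at this
    nlinarith
  set t : ℝ := ‖p Ω‖ ^ 2 with ht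
  have ht0 : 0 < t := by have := norm_pos_iff.mpr hzero; positivity
  have ht1 : 0 < ‖Ω - p Ω‖ ^ 2 := by
    have := norm_pos_iff.mpr (sub_ne_zero.mpr (Ne.symm hone)); positivity
  obtain ⟨g₁, hg₁n, hg₁⟩ := aux_vecFunctional π (p Ω)
  obtain ⟨g₂, hg₂n, hg₂⟩ := aux_vecFunctional π (Ω - p Ω)
  have ht2 : ‖Ω - p Ω‖ ^ 2 = 1 - t := by linarith
  rw [ht2] at ht1 hg₂n
  have mem : ∀ (s : ℝ) (v : H) (g : B →L[ℂ] ℂ), 0 < s → ‖v‖ ^ 2 = s → ‖g‖ ≤ s →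
      (∀ a, g a = ⟪v, π a v⟫_ℂ) → (∀ x ∈ L, π x v = 0) →
      ((s⁻¹ : ℝ) : ℂ) • g ∈ auxStates L := by
    intro s v g hs hv hgn hg hk
    refine ⟨?_, ?_, ?_⟩
    · rw [norm_smul, Complex.norm_real, Real.norm_of_nonneg (by positivity)]
      rw [inv_mul_le_iff₀ hs]; simpa using hgn
    · have : g 1 = (s : ℂ) := by
        rw [hg, map_one, one_apply_eq_self, inner_self_eq_norm_sq_to_K, ← hv]
        norm_cast
      have hs' : (s : ℂ) ≠ 0 := by exact_mod_cast hs.ne'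
      simp [this, hs']
    · intro x hx
      simp [hg, hk x hx]
  have hk₁ : ∀ x ∈ L, π x (p Ω) = 0 := fun x hx => by rw [← hcomm, hkill x hx, map_zero]
  have hk₂ : ∀ x ∈ L, π x (Ω - p Ω) = 0 := fun x hx => by
    rw [map_sub, hk₁ x hx, hkill x hx, sub_zero]
  have hdec : f = (t : ℂ) • (((t⁻¹ : ℝ) : ℂ) • g₁) +
      ((1 - t : ℝ) : ℂ) • ((((1 - t)⁻¹ : ℝ) : ℂ) • g₂) := by
    have e1 : (t : ℂ) * ((t⁻¹ : ℝ) : ℂ) = 1 := by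
      norm_cast; exact mul_inv_cancel₀ ht0.ne'
    have e2 : ((1 - t : ℝ) : ℂ) * (((1 - t)⁻¹ : ℝ) : ℂ) = 1 := by
      norm_cast; exact mul_inv_cancel₀ ht1.ne'
    rw [smul_smul, smul_smul, e1, e2, one_smul, one_smul]
    ext a
    rw [add_apply, hg₁, hg₂, hfΩ]
    have c1 : ⟪p Ω, π a (Ω - p Ω)⟫_ℂ = 0 := by
      rw [hpsa, hcomm, map_sub, hpp, sub_self, map_zero, inner_zero_right]
    have c2 : ⟪Ω - p Ω, π a (p Ω)⟫_ℂ = 0 := by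
      rw [← hcomm, ← hpsa, map_sub, hpp, sub_self, inner_zero_left]
    have : ⟪Ω, π a Ω⟫_ℂ = ⟪p Ω + (Ω - p Ω), π a (p Ω + (Ω - p Ω))⟫_ℂ := by
      rw [add_sub_cancel]
    rw [this, map_add, inner_add_left, inner_add_right, inner_add_right, c1, c2]
    ring
  have hfin := hext _ (mem t (p Ω) g₁ ht0 rfl hg₁n hg₁ hk₁) _
    (mem (1 - t) (Ω - p Ω) g₂ ht1 ht2 hg₂n hg₂ hk₂) t ht0 (by linarith) hdec
  have hpΩ : p Ω = (t : ℂ) • Ω := by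
    rw [← sub_eq_zero]
    have horth : ∀ v, ⟪p Ω - (t : ℂ) • Ω, v⟫_ℂ = 0 := by
      intro v
      have hcl : IsClosed {v : H | ⟪p Ω - (t : ℂ) • Ω, v⟫_ℂ = 0} :=
        isClosed_eq (by fun_prop) continuous_const
      have hsub : {η : H | ∃ a : B, η = π a Ω} ⊆ {v : H | ⟪p Ω - (t : ℂ) • Ω, v⟫_ℂ = 0} := by
        rintro _ ⟨a, rfl⟩
        have h := congrArg (fun g : B →L[ℂ] ℂ => g a) hfin
        simp only [smul_apply, smul_eq_mul, hg₁, hfΩ] at h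
        have h2 : ⟪p Ω, π a (p Ω)⟫_ℂ = ⟪p Ω, π a Ω⟫_ℂ := by
          rw [← hcomm, ← hpsa, hpp]
        rw [h2] at h
        have e1 : (t : ℂ) * ((t⁻¹ : ℝ) : ℂ) = 1 := by
          norm_cast; exact mul_inv_cancel₀ ht0.ne'
        simp only [Set.mem_ofPred_eq, inner_sub_left, inner_smul_left, Complex.conj_ofReal]
        rw [← h, ← mul_assoc, e1, one_mul, sub_self]
      have := hcl.closure_subset_iff.mpr hsub
      rw [hdense.closure_eq] at this
      exact this (Set.mem_univ v)
    exact inner_self_eq_zero.mp (horth _)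
  have h1 := hscal t hpΩ ξ
  rw [hpξ] at h1
  have h2 : ((1 : ℂ) - t) • ξ = 0 := by rw [sub_smul, one_smul, ← h1, sub_self]
  rcases smul_eq_zero.mp h2 with h | h
  · have : (1 : ℝ) - t = 0 := by exact_mod_cast h
    linarith
  · exact hξ h

end Helpers2

section Helpers3

open scoped InnerProductSpace

variable {B : Type u} [CStarAlgebra B]

theorem pi_alg (R : IrrRep B) (r : ℝ) : R.π (algebraMap ℝ B r) = algebraMap ℝ _ r := by
  have h : (algebraMap ℝ B r) = algebraMap ℂ B (r : ℂ) := rfl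
  rw [h]
  exact AlgHomClass.commutes R.π (r : ℂ)

theorem pi_rsmul (R : IrrRep B) (r : ℝ) (x : B) : R.π (r • x) = r • R.π x := by
  rw [Algebra.smul_def, map_mul, pi_alg, ← Algebra.smul_def]

theorem irr_vec (R : IrrRep B) (a : B) (ha : R.π a ≠ 0) (ξ : R.H) (hξ : ξ ≠ 0) :
    ∃ c, R.π (a * c) ξ ≠ 0 := by
  by_contra hcon
  push Not at hcon
  apply ha
  ext v
  have hcl : IsClosed {v : R.H | R.π a v = 0} := isClosed_eq (R.π a).continuous continuous_const
  have hsub : {η : R.H | ∃ b : B, η = R.π b ξ} ⊆ {v : R.H | R.π a v = 0} := by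
    rintro _ ⟨b, rfl⟩
    have := hcon b
    rwa [map_mul, mul_apply_eq_comp] at this
  have := hcl.closure_subset_iff.mpr hsub
  rw [(R.irr ξ hξ).closure_eq] at this
  exact this (Set.mem_univ v)

theorem irr_prime (R : IrrRep B) (a b : B) (ha : R.π a ≠ 0) (hb : R.π b ≠ 0) :
    ∃ c, R.π (a * c * b) ≠ 0 := by
  obtain ⟨ξ, hξ⟩ : ∃ ξ, R.π b ξ ≠ 0 := by
    by_contra hcon
    push Not at hcon
    exact hb (by ext v; exact hcon v)
  obtain ⟨c, hc⟩ := irr_vec R a ha _ hξ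
  refine ⟨c, fun h => hc ?_⟩
  rw [← mul_apply_eq_comp, ← map_mul, h]
  rfl

variable [PartialOrder B] [StarOrderedRing B]

theorem pi_mono (R : IrrRep B) {x y : B} (h : x ≤ y) : R.π x ≤ R.π y := by
  exact OrderHomClass.mono R.π h

theorem pi_negPart (R : IrrRep B) (k : B) (hk : IsSelfAdjoint k) : R.π k⁻ = (R.π k)⁻ := by
  rw [CFC.negPart_def, CFC.negPart_def]
  have hc : Continuous R.π := by
    exact AddMonoidHomClass.continuous_of_bound R.π 1 fun x => by
      simpa using NonUnitalStarAlgHom.norm_apply_le R.π x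
  exact NonUnitalStarAlgHomClass.map_cfcₙ (S := ℂ) R.π _ k

theorem pi_negPart_zero (R : IrrRep B) (k : B) (hk : IsSelfAdjoint k) :
    R.π k⁻ = 0 ↔ 0 ≤ R.π k := by
  rw [pi_negPart R k hk, CFC.negPart_eq_zero_iff _ (hk.map R.π)]

theorem faith_nonneg (x : B) (hx : IsSelfAdjoint x) (h : ∀ R : IrrRep B, 0 ≤ R.π x) : 0 ≤ x := by
  rw [StarOrderedRing.nonneg_iff_spectrum_nonneg (R := ℝ) x hx]
  intro l hl
  by_contra hneg
  push Not at hneg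
  let L : Ideal B := Ideal.span {algebraMap ℝ B l - x}
  have hL : (1 : B) ∉ L := by
    intro h1
    obtain ⟨y, hy⟩ := Ideal.mem_span_singleton'.mp h1
    apply hl
    have hsa : IsSelfAdjoint (algebraMap ℝ B l - x) :=
      (IsSelfAdjoint.algebraMap B (IsSelfAdjoint.all l)).sub hx
    have h2 : (algebraMap ℝ B l - x) * star y = 1 := by
      have := congrArg star hy
      rwa [star_mul, hsa.star_eq, star_one] at this
    have : y = star y := left_inv_eq_right_inv hy h2
    exact ⟨⟨_, star y, h2, by rw [← this]; exact hy⟩, rfl⟩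
  obtain ⟨R, ξ, hξ, hk⟩ := aux_irr L hL
  have h1 := hk _ (Ideal.subset_span rfl)
  rw [map_sub, pi_alg] at h1
  have h2 : R.π x ξ = (l : ℂ) • ξ := by
    rw [sub_apply, sub_eq_zero] at h1
    rw [← h1]; rfl
  have h3 := (ContinuousLinearMap.nonneg_iff_isPositive _).mp (h R)
  have h4 := h3.re_inner_nonneg_left ξ
  rw [h2, inner_smul_left, inner_self_eq_norm_sq_to_K] at h4
  have h5 : 0 < ‖ξ‖ := norm_pos_iff.mpr hξ
  have h6 : (0:ℝ) ≤ l * ‖ξ‖ ^ 2 := by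
    have : ((starRingEnd ℂ) (l:ℂ) * ((‖ξ‖ : ℝ) : ℂ) ^ 2) = ((l * ‖ξ‖ ^ 2 : ℝ) : ℂ) := by
      rw [Complex.conj_ofReal]; push_cast; rfl
    erw [this] at h4
    exact h4
  nlinarith [mul_pos h5 h5]

theorem faith_le (x y : B) (hx : IsSelfAdjoint x) (hy : IsSelfAdjoint y)
    (h : ∀ R : IrrRep B, R.π x ≤ R.π y) : x ≤ y := by
  rw [← sub_nonneg]
  refine faith_nonneg _ (hy.sub hx) fun R => ?_
  rw [map_sub, sub_nonneg]; exact h R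

theorem faith_norm (x : B) (c : ℝ) (hc : 0 ≤ c) (h : ∀ R : IrrRep B, ‖R.π x‖ ≤ c) : ‖x‖ ≤ c := by
  have h1 : star x * x ≤ algebraMap ℝ B (c ^ 2) := by
    refine faith_le _ _ (IsSelfAdjoint.star_mul_self x)
      (IsSelfAdjoint.algebraMap B (IsSelfAdjoint.all _)) fun R => ?_
    rw [map_mul, map_star, pi_alg]
    refine (CStarAlgebra.star_mul_le_algebraMap_norm_sq).trans ?_
    apply algebraMap_mono
    have := h R
    gcongr
  have h2 : ‖star x * x‖ ≤ c ^ 2 :=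
    (CStarAlgebra.norm_le_iff_le_algebraMap _ (by positivity) (star_mul_self_nonneg x)).mpr h1
  rw [CStarRing.norm_star_mul_self] at h2
  nlinarith [norm_nonneg x]

theorem faith_zero (x : B) (h : ∀ R : IrrRep B, R.π x = 0) : x = 0 := by
  have := faith_norm x 0 le_rfl (fun R => by rw [h R]; simp)
  exact norm_le_zero_iff.mp this

end Helpers3

section Helpers4

open scoped InnerProductSpace

variable {B : Type u} [CStarAlgebra B]

/-- Separation property of the primitive spectrum in terms of elements. -/
def SepProp (B : Type u) [CStarAlgebra B] : Prop :=
  ∀ R₁ R₂ : IrrRep B, {a | R₁.π a = 0} ≠ {a | R₂.π a = 0} →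
    ∃ a b, R₁.π a ≠ 0 ∧ R₂.π b ≠ 0 ∧ ∀ R₃ : IrrRep B, R₃.π a = 0 ∨ R₃.π b = 0

theorem isPrimitive_ker (R : IrrRep B) : IsPrimitiveIdeal {a : B | R.π a = 0} := by
  let π' : B →L[ℂ] (R.H →L[ℂ] R.H) :=
    LinearMap.mkContinuous (R.π : B →ₐ[ℂ] (R.H →L[ℂ] R.H)).toLinearMap 1 fun x => by
      simpa using NonUnitalStarAlgHom.norm_apply_le R.π x
  exact ⟨{ space := R.H, π := π', map_mul' := fun x y => map_mul R.π x y,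
           map_star' := fun x => map_star R.π x, map_one' := map_one R.π,
           irreducible' := R.irr, ker_eq' := rfl }⟩

theorem sepProp_of_hausdorff (hT2 : HasHausdorffPrimitiveSpectrum B) : SepProp B := by
  intro R₁ R₂ hne
  obtain ⟨I, J, -, -, hI, hJ, h⟩ := hT2 _ _ (isPrimitive_ker R₁) (isPrimitive_ker R₂) hne
  obtain ⟨a, ha, ha'⟩ := Set.not_subset.mp hI
  obtain ⟨b, hb, hb'⟩ := Set.not_subset.mp hJ
  refine ⟨a, b, ha', hb', fun R₃ => ?_⟩
  rcases h _ (isPrimitive_ker R₃) with h | h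
  · exact Or.inl (h ha)
  · exact Or.inr (h hb)

variable [PartialOrder B] [StarOrderedRing B]

/-- the elements vanishing near `R₀`. -/
def localIdeal (R₀ : IrrRep B) : Ideal B where
  carrier := {b | ∃ a, R₀.π a ≠ 0 ∧ ∀ R : IrrRep B, R.π a = 0 ∨ R.π b = 0}
  zero_mem' := ⟨1, by simp, fun R => Or.inr (map_zero _)⟩
  add_mem' := by
    rintro x y ⟨a, ha, hax⟩ ⟨b, hb, hby⟩
    obtain ⟨c, hc⟩ := irr_prime R₀ a b ha hb
    refine ⟨_, hc, fun R => ?_⟩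
    rcases hax R with h | h
    · left; simp [h]
    rcases hby R with h' | h'
    · left; simp [h']
    · right; simp [h, h']
  smul_mem' := by
    rintro c x ⟨a, ha, hax⟩
    refine ⟨a, ha, fun R => ?_⟩
    rcases hax R with h | h
    · left; exact h
    · right; simp [h]

theorem localIdeal_mul_right (R₀ : IrrRep B) (x c : B) (hx : x ∈ localIdeal R₀) :
    x * c ∈ localIdeal R₀ := by
  obtain ⟨a, ha, hax⟩ := hx
  refine ⟨a, ha, fun R => ?_⟩
  rcases hax R with h | h
  · left; exact h
  · right; simp [h]

theorem isSelfAdjoint_alg (r : ℝ) : IsSelfAdjoint (algebraMap ℝ B r) :=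
  IsSelfAdjoint.algebraMap B (IsSelfAdjoint.all r)

theorem lemmaU (hT : SepProp B) (R₀ : IrrRep B) (h : B) (hh : IsSelfAdjoint h) (β' β : ℝ)
    (hβ : β' < β) (h0 : R₀.π h ≤ algebraMap ℝ _ β') :
    ∃ a, R₀.π a ≠ 0 ∧ ∀ R : IrrRep B, R.π a = 0 ∨ R.π h ≤ algebraMap ℝ _ β := by
  set k : B := algebraMap ℝ B β - h with hk
  have hksa : IsSelfAdjoint k := (isSelfAdjoint_alg β).sub hh
  set k' : B := algebraMap ℝ B β' - h with hk'
  have hksa' : IsSelfAdjoint k' := (isSelfAdjoint_alg β').sub hh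
  suffices hmem : k⁻ ∈ localIdeal R₀ by
    obtain ⟨a, ha, hax⟩ := hmem
    refine ⟨a, ha, fun R => (hax R).imp id fun h1 => ?_⟩
    rw [pi_negPart_zero R k hksa, hk, map_sub, pi_alg, sub_nonneg] at h1
    exact h1
  let L' : Ideal B := localIdeal R₀ ⊔ Ideal.span {k⁺}
  by_cases h1 : (1 : B) ∈ L'
  · obtain ⟨b, hb, y, hy, hby⟩ := Submodule.mem_sup.mp h1
    obtain ⟨x, rfl⟩ := Ideal.mem_span_singleton'.mp hy
    have : k⁻ = b * k⁻ := by
      calc k⁻ = (b + x * k⁺) * k⁻ := by rw [hby, one_mul]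
        _ = b * k⁻ := by rw [add_mul, mul_assoc, CFC.posPart_mul_negPart, mul_zero, add_zero]
    rw [this]
    exact localIdeal_mul_right R₀ _ _ hb
  · exfalso
    obtain ⟨R, ξ, hξ, hkill⟩ := aux_irr L' h1
    have hLker : ∀ x ∈ localIdeal R₀, R.π x = 0 := by
      intro x hx
      by_contra hne
      obtain ⟨c, hc⟩ := irr_vec R x hne ξ hξ
      exact hc (hkill _ (Submodule.mem_sup_left (localIdeal_mul_right R₀ x c hx)))
    have hker : {a | R₀.π a = 0} = {a | R.π a = 0} := by
      by_contra hne
      obtain ⟨a, b, ha, hb, hab⟩ := hT R₀ R hne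
      exact hb (hLker b ⟨a, ha, hab⟩)
    have h2 : R₀.π k'⁻ = 0 := by
      rw [pi_negPart_zero R₀ k' hksa', hk', map_sub, pi_alg, sub_nonneg]
      exact h0
    have h3 : R.π k'⁻ = 0 := by
      have : k'⁻ ∈ {a | R₀.π a = 0} := h2
      rw [hker] at this
      exact this
    rw [pi_negPart_zero R k' hksa'] at h3
    have h4 : algebraMap ℝ _ (β - β') ≤ R.π k := by
      have : k = algebraMap ℝ B (β - β') + k' := by
        rw [hk, hk', map_sub]; abel
      rw [this, map_add, pi_alg]
      exact le_add_of_nonneg_right h3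
    have h5 : R.π k ≤ R.π k⁺ := by
      refine pi_mono R ?_
      have := CFC.posPart_sub_negPart k hksa
      calc k = k⁺ - k⁻ := this.symm
        _ ≤ k⁺ := sub_le_self _ (CFC.negPart_nonneg k)
    have h6 := h4.trans h5
    rw [ContinuousLinearMap.le_def] at h6
    have h7 := h6.re_inner_nonneg_left ξ
    have h8 : R.π k⁺ ξ = 0 := hkill _ (Submodule.mem_sup_right (Ideal.subset_span rfl))
    have h9 : (R.π k⁺ - algebraMap ℝ (R.H →L[ℂ] R.H) (β - β')) ξ = ((-(β - β') : ℝ) : ℂ) • ξ := by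
      rw [sub_apply, h8, zero_sub, Complex.ofReal_neg, neg_smul]
      rfl
    rw [h9, inner_smul_left, inner_self_eq_norm_sq_to_K] at h7
    have h5 : 0 < ‖ξ‖ := norm_pos_iff.mpr hξ
    have h6 : (0:ℝ) ≤ (-(β - β')) * ‖ξ‖ ^ 2 := by
      have : ((starRingEnd ℂ) ((-(β - β') : ℝ):ℂ) * ((‖ξ‖ : ℝ) : ℂ) ^ 2) =
          (((-(β - β')) * ‖ξ‖ ^ 2 : ℝ) : ℂ) := by
        rw [Complex.conj_ofReal]; push_cast; rfl
      erw [this] at h7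
      exact h7
    nlinarith [mul_pos h5 h5]

/-- good elements -/
def Good (h : B) (δ : ℝ) (v : B) : Prop :=
  ∀ R : IrrRep B, (‖R.π h‖ - δ) • R.π (star v * v) ≤ R.π (star v * h * v)

theorem Good.mul_right {h : B} {δ : ℝ} {v : B} (hv : Good h δ v) (x : B) : Good h δ (v * x) := by
  intro R
  have := star_left_conjugate_le_conjugate (hv R) (R.π x)
  calc (‖R.π h‖ - δ) • R.π (star (v * x) * (v * x))
      = star (R.π x) * ((‖R.π h‖ - δ) • R.π (star v * v)) * R.π x := by
        rw [mul_smul_comm, smul_mul_assoc, ← map_star, ← map_mul, ← map_mul]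
        simp only [star_mul, mul_assoc]
    _ ≤ _ := this
    _ = _ := by
        rw [← map_star, ← map_mul, ← map_mul]
        simp only [star_mul, mul_assoc]

theorem lemmaV (hT : SepProp B) (R₀ : IrrRep B) (h : B) (hh : 0 ≤ h) (ε : ℝ) (hε : 0 < ε) :
    ∃ v, R₀.π v ≠ 0 ∧ Good h (2 * ε) v := by
  have hsa : IsSelfAdjoint h := hh.isSelfAdjoint
  set t₀ := ‖R₀.π h‖ with ht₀
  have hle : R₀.π h ≤ algebraMap ℝ _ t₀ := (hsa.map R₀.π).le_algebraMap_norm_self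
  obtain ⟨a, ha, hax⟩ := lemmaU hT R₀ h hsa t₀ (t₀ + ε) (by linarith) hle
  set k : B := algebraMap ℝ B (t₀ - ε) - h with hk
  have hksa : IsSelfAdjoint k := (isSelfAdjoint_alg _).sub hsa
  have hg : R₀.π k⁻ ≠ 0 := by
    intro h0
    rw [pi_negPart_zero R₀ k hksa, hk, map_sub, pi_alg, sub_nonneg] at h0
    have hpos : 0 ≤ R₀.π h := map_zero R₀.π ▸ pi_mono R₀ hh
    by_cases hα : 0 ≤ t₀ - ε
    · have := (CStarAlgebra.norm_le_iff_le_algebraMap _ hα hpos).mpr h0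
      linarith
    · push Not at hα
      have h1 : (0 : R₀.H →L[ℂ] R₀.H) ≤ algebraMap ℝ _ (t₀ - ε) := hpos.trans h0
      have h2 : algebraMap ℝ (R₀.H →L[ℂ] R₀.H) (t₀ - ε) ≤ 0 := by
        rw [← map_zero (algebraMap ℝ (R₀.H →L[ℂ] R₀.H))]
        exact algebraMap_mono _ hα.le
      have h3 := le_antisymm h2 h1
      rw [map_eq_zero_iff _ (algebraMap ℝ (R₀.H →L[ℂ] R₀.H)).injective] at h3
      linarith
  obtain ⟨c, hc⟩ := irr_prime R₀ _ a hg ha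
  refine ⟨_, hc, ?_⟩
  intro R
  rcases hax R with h0 | h0
  · simp [h0]
  have hpos : 0 ≤ R.π h := map_zero R.π ▸ pi_mono R hh
  have hβ : 0 ≤ t₀ + ε := by positivity
  have htR : ‖R.π h‖ ≤ t₀ + ε := (CStarAlgebra.norm_le_iff_le_algebraMap _ hβ hpos).mpr h0
  have key : (t₀ - ε) • (star k⁻ * k⁻) ≤ star k⁻ * h * k⁻ := by
    have hgsa : star k⁻ = k⁻ := (CFC.negPart_nonneg k).isSelfAdjoint.star_eq
    have h1 : star k⁻ * h * k⁻ - (t₀ - ε) • (star k⁻ * k⁻) = star k⁻ * k⁻ * k⁻ := by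
      have h2 : k * k⁻ = - (k⁻ * k⁻) := by
        calc k * k⁻ = (k⁺ - k⁻) * k⁻ := by rw [CFC.posPart_sub_negPart k hksa]
          _ = - (k⁻ * k⁻) := by rw [sub_mul, CFC.posPart_mul_negPart, zero_sub]
      have h3 : h = algebraMap ℝ B (t₀ - ε) - k := by rw [hk]; abel
      rw [h3, mul_sub, sub_mul, mul_assoc (star k⁻) k, h2, Algebra.smul_def,
        ← Algebra.commutes (t₀ - ε) (star k⁻)]
      simp [mul_assoc]
    rw [← sub_nonneg, h1, hgsa]
    have := star_left_conjugate_nonneg (CFC.negPart_nonneg k) k⁻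
    rwa [hgsa] at this
  have key2 : (t₀ - ε) • (star (k⁻ * c * a) * (k⁻ * c * a)) ≤
      star (k⁻ * c * a) * h * (k⁻ * c * a) := by
    have := star_left_conjugate_le_conjugate key (c * a)
    convert this using 1
    · rw [mul_smul_comm, smul_mul_assoc]
      simp only [star_mul, mul_assoc]
    · simp only [star_mul, mul_assoc]
  have key3 := pi_mono R key2
  rw [pi_rsmul] at key3
  refine le_trans ?_ key3
  have hp : 0 ≤ R.π (star (k⁻ * c * a) * (k⁻ * c * a)) :=
    map_zero R.π ▸ pi_mono R (star_mul_self_nonneg _)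
  exact smul_le_smul_of_nonneg_right (by linarith) hp

end Helpers4

section Helpers5

variable {B : Type u} [CStarAlgebra B] [PartialOrder B] [StarOrderedRing B]

/-- sums of `v* v` over good elements -/
def GoodSum (h : B) (δ : ℝ) (s : B) : Prop :=
  ∃ (n : ℕ) (v : Fin n → B), (∀ i, Good h δ (v i)) ∧ s = ∑ i, star (v i) * v i

theorem GoodSum.add {h : B} {δ : ℝ} {s t : B} (hs : GoodSum h δ s) (ht : GoodSum h δ t) :
    GoodSum h δ (s + t) := by
  obtain ⟨n, v, hv, rfl⟩ := hs
  obtain ⟨m, w, hw, rfl⟩ := ht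
  refine ⟨n + m, Fin.append v w, ?_, ?_⟩
  · intro i
    refine Fin.addCases (fun i => ?_) (fun i => ?_) i
    · simpa using hv i
    · simpa using hw i
  · rw [Fin.sum_univ_add]; simp

theorem GoodSum.smul {h : B} {δ : ℝ} {s : B} (hs : GoodSum h δ s) {M : ℝ} (hM : 0 ≤ M) :
    GoodSum h δ (M • s) := by
  obtain ⟨n, v, hv, rfl⟩ := hs
  refine ⟨n, fun i => v i * algebraMap ℝ B (Real.sqrt M), fun i => (hv i).mul_right _, ?_⟩
  rw [Finset.smul_sum]
  refine Finset.sum_congr rfl fun i _ => ?_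
  have e : v i * algebraMap ℝ B (Real.sqrt M) = Real.sqrt M • v i := by
    rw [← Algebra.commutes, Algebra.smul_def]
  simp only [e]
  rw [star_smul, star_trivial (Real.sqrt M), smul_mul_smul_comm, Real.mul_self_sqrt hM]

theorem GoodSum.nonneg {h : B} {δ : ℝ} {s : B} (hs : GoodSum h δ s) : 0 ≤ s := by
  obtain ⟨n, v, hv, rfl⟩ := hs
  exact Finset.sum_nonneg fun i _ => star_mul_self_nonneg _

/-- the left ideal dominated by good sums -/
def goodIdeal (h : B) (δ : ℝ) : Ideal B where
  carrier := {c | ∃ s, GoodSum h δ s ∧ star c * c ≤ s}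
  zero_mem' := ⟨0, ⟨0, Fin.elim0, fun i => i.elim0, by simp⟩, by simp⟩
  add_mem' := by
    rintro x y ⟨s, hs, hxs⟩ ⟨t, ht, hyt⟩
    refine ⟨(2 : ℝ) • (s + t), (hs.add ht).smul (by norm_num), ?_⟩
    have h1 : star (x + y) * (x + y) = (2 : ℝ) • (star x * x + star y * y) -
        star (x - y) * (x - y) := by
      rw [two_smul, star_add, star_sub]
      noncomm_ring
    rw [h1]
    refine (sub_le_self _ (star_mul_self_nonneg _)).trans ?_
    exact smul_le_smul_of_nonneg_left (add_le_add hxs hyt) (by norm_num)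
  smul_mem' := by
    rintro c x ⟨s, hs, hxs⟩
    refine ⟨(‖c‖ ^ 2) • s, hs.smul (by positivity), ?_⟩
    have h1 := star_left_conjugate_le_conjugate
      (CStarAlgebra.star_mul_le_algebraMap_norm_sq (a := c)) x
    calc star (c • x) * (c • x) = star x * (star c * c) * x := by
          simp only [smul_eq_mul, star_mul, mul_assoc]
      _ ≤ _ := h1
      _ = (‖c‖ ^ 2) • (star x * x) := by
          rw [← Algebra.commutes, mul_assoc, Algebra.smul_def]
      _ ≤ _ := smul_le_smul_of_nonneg_left hxs (by positivity)

theorem lemmaW (hT : SepProp B) (h : B) (hh : 0 ≤ h) (δ : ℝ) (hδ : 0 < δ) :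
    ∃ s, GoodSum h δ s ∧ 1 ≤ s := by
  suffices h1 : (1 : B) ∈ goodIdeal h δ by
    obtain ⟨s, hs, hle⟩ := h1
    exact ⟨s, hs, by simpa using hle⟩
  by_contra h1
  obtain ⟨R, ξ, hξ, hkill⟩ := aux_irr _ h1
  obtain ⟨v, hv, hgood⟩ := lemmaV hT R h hh (δ / 2) (by linarith)
  rw [mul_div_cancel₀ _ (two_ne_zero)] at hgood
  obtain ⟨c, hc⟩ := irr_vec R v hv ξ hξ
  refine hc (hkill _ ⟨star (v * c) * (v * c), ⟨1, fun _ => v * c, fun _ => hgood.mul_right c, ?_⟩,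
    le_rfl⟩)
  simp

theorem lemmaX (hT : SepProp B) (h : B) (hh : 0 ≤ h) (δ : ℝ) (hδ : 0 < δ) :
    ∃ (n : ℕ) (a : Fin n → B), (∑ i, star (a i) * a i) = 1 ∧ ∀ R : IrrRep B,
      ‖R.π (∑ i, star (a i) * h * a i) - algebraMap ℝ _ ‖R.π h‖‖ ≤ δ := by
  obtain ⟨s, ⟨n, v, hv, hs⟩, h1⟩ := lemmaW hT h hh δ hδ
  have hsp : IsStrictlyPositive s := IsStrictlyPositive.of_le isStrictlyPositive_one h1
  set q := s ^ (-(1 / 2) : ℝ) with hq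
  have hqq : q * s * q = 1 := CFC.conjugate_rpow_neg_one_half s
  have hqsa : star q = q := (CFC.rpow_nonneg (a := s)).isSelfAdjoint.star_eq
  have hone : (∑ i, star (v i * q) * (v i * q)) = 1 := by
    rw [← hqq, hs, Finset.mul_sum, Finset.sum_mul]
    refine Finset.sum_congr rfl fun i _ => ?_
    rw [star_mul, hqsa]; simp only [mul_assoc]
  generalize hadef : (fun i => v i * q) = a at *
  have ha : ∀ i, Good h δ (a i) := fun i => hadef ▸ (hv i).mul_right q
  have hone' : (∑ i, star (a i) * a i) = 1 := by rw [← hadef]; exact hone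
  refine ⟨n, a, hone', fun R => ?_⟩
  have hup : R.π (∑ i, star (a i) * h * a i) ≤ algebraMap ℝ _ ‖R.π h‖ := by
    have e : algebraMap ℝ (R.H →L[ℂ] R.H) ‖R.π h‖ =
        ∑ i, star (R.π (a i)) * algebraMap ℝ _ ‖R.π h‖ * R.π (a i) := by
      have := congrArg (fun x => algebraMap ℝ (R.H →L[ℂ] R.H) ‖R.π h‖ * R.π x) hone'
      simp only [map_one, mul_one, map_sum, Finset.mul_sum] at this
      refine this.symm.trans (Finset.sum_congr rfl fun i _ => ?_)
      rw [map_mul, map_star, ← mul_assoc, Algebra.commutes]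
    rw [e, map_sum]
    refine Finset.sum_le_sum fun i _ => ?_
    rw [map_mul, map_mul, map_star]
    exact star_left_conjugate_le_conjugate (hh.isSelfAdjoint.map R.π).le_algebraMap_norm_self _
  have hlo : algebraMap ℝ _ (‖R.π h‖ - δ) ≤ R.π (∑ i, star (a i) * h * a i) := by
    have e : algebraMap ℝ (R.H →L[ℂ] R.H) (‖R.π h‖ - δ) =
        ∑ i, (‖R.π h‖ - δ) • R.π (star (a i) * a i) := by
      rw [← Finset.smul_sum, ← map_sum, hone', map_one, Algebra.algebraMap_eq_smul_one]
    rw [e, map_sum]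
    exact Finset.sum_le_sum fun i _ => ha i R
  rw [norm_sub_rev]
  refine (CStarAlgebra.norm_le_iff_le_algebraMap _ hδ.le (sub_nonneg.mpr hup)).mpr ?_
  rw [map_sub] at hlo
  rw [sub_le_iff_le_add]
  rw [sub_le_iff_le_add] at hlo
  rwa [add_comm]

theorem lemmaZ (hT : SepProp B) (h : B) (hh : 0 ≤ h) :
    ∃ z ∈ Set.center B, h ≤ z ∧ ∀ ε : ℝ, 0 < ε → ∃ (n : ℕ) (a : Fin n → B),
      (∑ i, star (a i) * a i) = 1 ∧ ‖(∑ i, star (a i) * h * a i) - z‖ ≤ ε := by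
  choose n a hone hR using fun k : ℕ => lemmaX hT h hh (1 / ((k : ℝ) + 1)) (by positivity)
  set y : ℕ → B := fun k => ∑ i, star (a k i) * h * a k i with hy
  have hlim : Filter.Tendsto (fun k : ℕ => 1 / ((k : ℝ) + 1)) Filter.atTop (nhds 0) :=
    tendsto_one_div_add_atTop_nhds_zero_nat
  have hlim2 : Filter.Tendsto (fun k : ℕ => 1 / ((k : ℝ) + 1) + 1 / ((k : ℝ) + 1))
      Filter.atTop (nhds 0) := by simpa using hlim.add hlim
  have hcau : CauchySeq y := by
    refine cauchySeq_of_le_tendsto_0 _ (fun k l N hk hl => ?_) hlim2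
    rw [dist_eq_norm]
    refine faith_norm _ _ (by positivity) fun R => ?_
    have h1 := (hR k R).trans (one_div_le_one_div_of_le (by positivity)
      (by gcongr : (N : ℝ) + 1 ≤ (k : ℝ) + 1))
    have h2 := (hR l R).trans (one_div_le_one_div_of_le (by positivity)
      (by gcongr : (N : ℝ) + 1 ≤ (l : ℝ) + 1))
    rw [norm_sub_rev] at h2
    rw [map_sub]
    calc ‖R.π (y k) - R.π (y l)‖ = ‖(R.π (y k) - algebraMap ℝ _ ‖R.π h‖) +
          (algebraMap ℝ _ ‖R.π h‖ - R.π (y l))‖ := by congr 1; abel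
      _ ≤ _ := norm_add_le _ _
      _ ≤ _ := add_le_add h1 h2
  obtain ⟨z, hz⟩ := cauchySeq_tendsto_of_complete hcau
  have hz' : Filter.Tendsto (fun k => ‖y k - z‖) Filter.atTop (nhds 0) :=
    tendsto_iff_norm_sub_tendsto_zero.mp hz
  have hzR : ∀ R : IrrRep B, R.π z = algebraMap ℝ _ ‖R.π h‖ := by
    intro R
    rw [← sub_eq_zero, ← norm_le_zero_iff]
    have hlim3 := hz'.add hlim
    rw [add_zero] at hlim3
    refine ge_of_tendsto' hlim3 fun k => ?_
    calc ‖R.π z - algebraMap ℝ _ ‖R.π h‖‖ =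
          ‖- R.π (y k - z) + (R.π (y k) - algebraMap ℝ _ ‖R.π h‖)‖ := by
          rw [map_sub]; congr 1; abel
      _ ≤ ‖- R.π (y k - z)‖ + ‖R.π (y k) - algebraMap ℝ _ ‖R.π h‖‖ := norm_add_le _ _
      _ ≤ _ := by
          rw [norm_neg]
          exact add_le_add (NonUnitalStarAlgHom.norm_apply_le R.π _) (hR k R)
  have hzsa : IsSelfAdjoint z := by
    rw [isSelfAdjoint_iff, ← sub_eq_zero]
    refine faith_zero _ fun R => ?_
    rw [map_sub, map_star, hzR R,
      (IsSelfAdjoint.algebraMap _ (IsSelfAdjoint.all _)).star_eq, sub_self]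
  refine ⟨z, ?_, ?_, ?_⟩
  · rw [Semigroup.mem_center_iff]
    intro x
    rw [← sub_eq_zero]
    refine faith_zero _ fun R => ?_
    rw [map_sub, map_mul, map_mul, hzR R, Algebra.commutes, sub_self]
  · refine faith_le _ _ hh.isSelfAdjoint hzsa fun R => ?_
    rw [hzR R]
    exact (hh.isSelfAdjoint.map R.π).le_algebraMap_norm_self
  · intro ε hε
    obtain ⟨k, hk⟩ := (hz'.eventually (gt_mem_nhds hε)).exists
    exact ⟨n k, a k, hone k, hk.le⟩

end Helpers5

section Helpers6

variable {B : Type u} [CStarAlgebra B]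

/-- the elementary map attached to a family -/
def elemMap {n : ℕ} (a : Fin n → B) : B →L[ℂ] B :=
  ∑ i, ((ContinuousLinearMap.mul ℂ B).flip (a i)).comp (ContinuousLinearMap.mul ℂ B (star (a i)))

theorem elemMap_apply {n : ℕ} (a : Fin n → B) (x : B) :
    elemMap a x = ∑ i, star (a i) * x * a i := by
  simp [elemMap]

theorem elemMap_mem {n : ℕ} (a : Fin n → B) (ha : (∑ i, star (a i) * a i) = 1)
    (ω : B →L[ℂ] ℂ) : ω.comp (elemMap a) ∈ mixSet ω :=
  ⟨elemMap a, ⟨n, a, ha, elemMap_apply a⟩, rfl⟩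

theorem mix_center (ω σ : B →L[ℂ] ℂ) (hσ : σ ∈ mixSet ω) (z : B) (hz : z ∈ Set.center B) :
    σ z = ω z := by
  obtain ⟨φ, ⟨n, a, ha, hφ⟩, rfl⟩ := hσ
  rw [Semigroup.mem_center_iff] at hz
  have : φ z = z := by
    rw [hφ]
    calc ∑ i, star (a i) * z * a i = ∑ i, z * (star (a i) * a i) :=
          Finset.sum_congr rfl fun i _ => by rw [hz, mul_assoc]
      _ = z := by rw [← Finset.mul_sum, ha, mul_one]
  simp [this]

theorem mix_state (ω σ : B →L[ℂ] ℂ) (hω : IsState ω) (hσ : σ ∈ mixSet ω) : IsState σ := by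
  obtain ⟨φ, ⟨n, a, ha, hφ⟩, rfl⟩ := hσ
  refine ⟨fun x => ?_, ?_⟩
  · rw [ContinuousLinearMap.comp_apply, hφ, map_sum]
    refine Finset.sum_nonneg fun i _ => ?_
    have := hω.1 (x * a i)
    rw [star_mul] at this
    simpa only [mul_assoc] using this
  · rw [ContinuousLinearMap.comp_apply, hφ]
    simp only [mul_one, ha]
    exact hω.2

theorem mix_convex (ω : B →L[ℂ] ℂ) (σ₁ σ₂ : B →L[ℂ] ℂ) (h₁ : σ₁ ∈ mixSet ω) (h₂ : σ₂ ∈ mixSet ω)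
    (s t : ℝ) (hs : 0 ≤ s) (ht : 0 ≤ t) (hst : s + t = 1) :
    (s : ℂ) • σ₁ + (t : ℂ) • σ₂ ∈ mixSet ω := by
  obtain ⟨φ, ⟨n, a, ha, hφ⟩, rfl⟩ := h₁
  obtain ⟨ψ, ⟨m, b, hb, hψ⟩, rfl⟩ := h₂
  have key : ∀ (r : ℝ) (c x : B), 0 ≤ r →
      star (((Real.sqrt r : ℝ) : ℂ) • c) * x * (((Real.sqrt r : ℝ) : ℂ) • c) =
        (r : ℂ) • (star c * x * c) := by
    intro r c x hr
    rw [star_smul, smul_mul_assoc, smul_mul_smul_comm]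
    congr 1
    rw [Complex.star_def, Complex.conj_ofReal, ← Complex.ofReal_mul, Real.mul_self_sqrt hr]
  have key1 : ∀ (r : ℝ) (c : B), 0 ≤ r →
      star (((Real.sqrt r : ℝ) : ℂ) • c) * (((Real.sqrt r : ℝ) : ℂ) • c) =
        (r : ℂ) • (star c * c) := by
    intro r c hr
    simpa using key r c 1 hr
  refine ⟨(s : ℂ) • φ + (t : ℂ) • ψ, ⟨n + m, Fin.append (fun i => ((Real.sqrt s : ℝ) : ℂ) • a i)
    (fun i => ((Real.sqrt t : ℝ) : ℂ) • b i), ?_, ?_⟩, ?_⟩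
  · rw [Fin.sum_univ_add]
    simp only [Fin.append_left, Fin.append_right, key1 s _ hs, key1 t _ ht]
    rw [← Finset.smul_sum, ← Finset.smul_sum, ha, hb, ← add_smul, ← Complex.ofReal_add, hst]
    simp
  · intro x
    rw [Fin.sum_univ_add]
    simp only [Fin.append_left, Fin.append_right, key s _ _ hs, key t _ _ ht]
    rw [← Finset.smul_sum, ← Finset.smul_sum, ← hφ, ← hψ]
    simp
  · ext x
    simp

variable [PartialOrder B] [StarOrderedRing B]

theorem state_nonneg (g : B →L[ℂ] ℂ) (hg : IsState g) (x : B) (hx : 0 ≤ x) : 0 ≤ g x := by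
  obtain ⟨b, rfl⟩ := CStarAlgebra.nonneg_iff_eq_star_mul_self.mp hx
  exact hg.1 b

theorem state_alg (g : B →L[ℂ] ℂ) (hg : IsState g) (r : ℝ) : g (algebraMap ℝ B r) = r := by
  have h : (algebraMap ℝ B r) = (r : ℂ) • (1 : B) := by
    rw [Algebra.algebraMap_eq_smul_one]; rfl
  rw [h, map_smul, hg.2]; simp

theorem shift_nonneg (x : B) (hx : IsSelfAdjoint x) : 0 ≤ x + algebraMap ℝ B ‖x‖ := by
  have := hx.neg_algebraMap_norm_le_self
  rwa [neg_le_iff_add_nonneg] at this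

theorem state_im (g : B →L[ℂ] ℂ) (hg : IsState g) (x : B) (hx : IsSelfAdjoint x) :
    (g x).im = 0 := by
  have h := state_nonneg g hg _ (shift_nonneg x hx)
  rw [map_add, state_alg g hg, Complex.nonneg_iff] at h
  simpa using h.2.symm

theorem state_re (g : B →L[ℂ] ℂ) (hg : IsState g) (y : B) :
    (g y).re = (g (realPart y : B)).re := by
  conv_lhs => rw [← realPart_add_I_smul_imaginaryPart y]
  rw [map_add, map_smul]
  have := state_im g hg (imaginaryPart y : B) (imaginaryPart y).2
  simp [this]

theorem main_aux (hT : SepProp B) (ω ρ : B →L[ℂ] ℂ) (hω : IsState ω) (hρ : IsState ρ)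
    (hc : ∀ z ∈ Set.center B, ρ z = ω z) (y : B) (u : ℝ)
    (hu : ∀ σ ∈ mixSet ω, (σ y).re < u) : (ρ y).re ≤ u := by
  by_contra hlt
  push Not at hlt
  set h₀ : B := (realPart y : B) with hh₀
  have hsa : IsSelfAdjoint h₀ := (realPart y).2
  set h : B := h₀ + algebraMap ℝ B ‖h₀‖ with hh
  have hpos : 0 ≤ h := shift_nonneg h₀ hsa
  have hval : ∀ g : B →L[ℂ] ℂ, IsState g → (g h).re = (g y).re + ‖h₀‖ := by
    intro g hg
    rw [hh, map_add, state_alg g hg, state_re g hg y]; simp [hh₀]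
  obtain ⟨z, hz, hle, happ⟩ := lemmaZ hT h hpos
  set d := (ρ y).re - u with hd
  have hd0 : 0 < d := by rw [hd]; linarith
  obtain ⟨n, a, ha, hna⟩ := happ (d / (‖ω‖ + 1)) (by positivity)
  have hmem := elemMap_mem a ha ω
  have h1 := hu _ hmem
  have h2 := hval _ (mix_state ω _ hω hmem)
  have h3 := hval ρ hρ
  have h4 : (ρ h).re ≤ (ρ z).re := by
    have := state_nonneg ρ hρ _ (sub_nonneg.mpr hle)
    rw [map_sub, Complex.nonneg_iff] at this
    have := this.1
    rw [Complex.sub_re] at this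
    linarith
  rw [hc z hz] at h4
  have h5 : (ω z).re - (ω.comp (elemMap a) h).re ≤ ‖ω‖ * (d / (‖ω‖ + 1)) := by
    rw [← elemMap_apply] at hna
    calc (ω z).re - (ω.comp (elemMap a) h).re = (ω (z - elemMap a h)).re := by simp
      _ ≤ ‖ω (z - elemMap a h)‖ := Complex.re_le_norm _
      _ ≤ ‖ω‖ * ‖z - elemMap a h‖ := ω.le_opNorm _
      _ ≤ _ := by
        rw [norm_sub_rev]
        gcongr
  have h6 : ‖ω‖ * (d / (‖ω‖ + 1)) ≤ d := by
    rw [mul_div_assoc', div_le_iff₀ (by positivity)]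
    nlinarith [norm_nonneg ω]
  linarith

theorem main_B (hT : SepProp B) (ω ρ : B →L[ℂ] ℂ) (hω : IsState ω) (hρ : IsState ρ) :
    InWeakStarClosure (mixSet ω) ρ ↔ ∀ z ∈ Set.center B, ρ z = ω z := by
  constructor
  · intro h z hz
    rw [← sub_eq_zero, ← norm_le_zero_iff]
    refine le_of_forall_pos_le_add fun ε hε => ?_
    obtain ⟨σ, hσ, hlt⟩ := h ε hε 1 (fun _ => z)
    have := hlt 0
    rw [mix_center ω σ hσ z hz] at this
    linarith
  · intro hc ε hε n x
    by_contra hcon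
    push Not at hcon
    let T : Set (Fin n → ℂ) := {p | ∃ σ ∈ mixSet ω, p = fun i => σ (x i)}
    have hconv : Convex ℝ T := by
      rintro _ ⟨σ₁, h₁, rfl⟩ _ ⟨σ₂, h₂, rfl⟩ s t hs ht hst
      refine ⟨_, mix_convex ω σ₁ σ₂ h₁ h₂ s t hs ht hst, ?_⟩
      ext i
      simp
    have hnot : (fun i => ρ (x i)) ∉ closure T := by
      intro hmem
      obtain ⟨_, ⟨σ, hσ, rfl⟩, hd⟩ := Metric.mem_closure_iff.mp hmem ε hε
      obtain ⟨i, hi⟩ := hcon σ hσ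
      have := (dist_pi_lt_iff hε).mp hd i
      rw [dist_eq_norm] at this
      linarith
    obtain ⟨f, u, hf1, hf2⟩ := RCLike.geometric_hahn_banach_closed_point (𝕜 := ℂ)
      hconv.closure isClosed_closure hnot
    let y : B := ∑ i, (f (fun j => if i = j then 1 else 0)) • x i
    have hy : ∀ g : B →L[ℂ] ℂ, f (fun i => g (x i)) = g y := by
      intro g
      have := LinearMap.pi_apply_eq_sum_univ (f : (Fin n → ℂ) →ₗ[ℂ] ℂ) (fun i => g (x i))
      refine this.trans ?_
      simp only [y, map_sum, map_smul, smul_eq_mul]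
      exact Finset.sum_congr rfl fun i _ => mul_comm _ _
    have hle := main_aux hT ω ρ hω hρ hc y u fun σ hσ => by
      have := hf1 _ (subset_closure ⟨σ, hσ, rfl⟩)
      rw [hy] at this
      exact this
    rw [hy] at hf2
    exact absurd hf2 (not_lt.mpr hle)

end Helpers6

/-- **Corollary.** Let `A` be a unital C*-algebra with Hausdorff primitive
spectrum and center `Z`. For states `ω`, `ρ` on `A`, `ρ` lies in the weak*
closure of `ω ∘ E(A)` if and only if `ρ|Z = ω|Z`. -/
theorem state_mem_weakStarClosure_iff_of_hausdorff
    (hT2 : HasHausdorffPrimitiveSpectrum A)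
    (ω ρ : A →L[ℂ] ℂ) (hω : IsState ω) (hρ : IsState ρ) :
    InWeakStarClosure (mixSet ω) ρ ↔ ∀ z ∈ Set.center A, ρ z = ω z := by
  letI : CStarAlgebra A := { }
  letI : PartialOrder A := CStarAlgebra.spectralOrder A
  letI : StarOrderedRing A := CStarAlgebra.spectralOrderedRing A
  exact main_B (sepProp_of_hausdorff hT2) ω ρ hω hρ

end
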